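/- arXiv:1101.5641 — 2 statements merged into one kernel-verified Lean document; each statement's English description precedes it below -/
import Mathlib

section
/- Let G be a connected simple graph with at least two vertices and let r be a vertex of G. Suppose z ∈ ℕ is such that every configuration C on G with C(r) = 0 satisfying w(C) ≤ w(𝐓) for every strategy (T,w) rooted at r has size |C| ≤ z. Then π(G,r) ≤ z + 1. -/
open Finset SimpleGraph

variable {V : Type*}

/-- A single pebbling move: remove two pebbles from `u` and add one pebble to a
neighbor `v`. -/
def PebblingMove (G : SimpleGraph V) (C C' : V → ℕ) : Prop :=
  ∃ u v : V, G.Adj u v ∧ 2 ≤ C u ∧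
    C' u = C u - 2 ∧ C' v = C v + 1 ∧ ∀ x : V, x ≠ u → x ≠ v → C' x = C x

/-- A configuration `C` is `r`-solvable if some finite sequence of pebbling moves
starting from `C` yields a configuration with at least one pebble on `r`. -/
def PebblingSolvable (G : SimpleGraph V) (r : V) (C : V → ℕ) : Prop :=
  ∃ C' : V → ℕ, Relation.ReflTransGen (PebblingMove G) C C' ∧ 1 ≤ C' r

/-- `piVertex G r` is the least `t` such that every configuration of size `t`
is `r`-solvable. -/
noncomputable def piVertex [Fintype V] (G : SimpleGraph V) (r : V) : ℕ :=
  sInf {t : ℕ | ∀ C : V → ℕ, (∑ v, C v) = t → PebblingSolvable G r C}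

/-- The pebbling number `π(G) = max_r π(G,r)`. -/
noncomputable def pebblingNumber [Fintype V] (G : SimpleGraph V) : ℕ :=
  Finset.univ.sup (fun r => piVertex G r)

/-- A (basic) strategy rooted at `r`: a subtree `T` of `G` containing `r` with
at least two vertices, together with a nonnegative, nonzero weight function `w`
vanishing off `T` and at `r`, with `w(v⁺) = 2·w(v)` for every vertex `v` of `T`
other than `r` and the children of `r`, where `v⁺` is the parent of `v`, i.e.
the neighbor of `v` on the path in `T` from `v` to `r`. -/
structure Strategy (G : SimpleGraph V) (r : V) where
  T : G.Subgraph
  w : V → ℚ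
  root_mem : r ∈ T.verts
  two_le_ncard : 2 ≤ T.verts.ncard
  isTree : T.coe.IsTree
  w_nonneg : ∀ v, 0 ≤ w v
  w_ne_zero : w ≠ 0
  w_outside : ∀ v, v ∉ T.verts → w v = 0
  w_root : w r = 0
  w_parent : ∀ u v : T.verts, T.coe.Adj u v → (v : V) ≠ r → ¬ T.Adj r (v : V) →
    T.coe.dist u ⟨r, root_mem⟩ < T.coe.dist v ⟨r, root_mem⟩ → w (u : V) = 2 * w (v : V)

/-- `w(C) = ∑_{v ∈ V(G)} w(v)·C(v)`. -/
noncomputable def configWeight [Fintype V] {G : SimpleGraph V} {r : V}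
    (S : Strategy G r) (C : V → ℕ) : ℚ :=
  ∑ v, S.w v * (C v : ℚ)

open Classical in
/-- `w(𝐓) = ∑_{v ∈ V(T), v ≠ r} w(v)`. -/
noncomputable def treeWeight [Fintype V] {G : SimpleGraph V} {r : V} (S : Strategy G r) : ℚ :=
  ∑ v ∈ Finset.univ.filter (fun v => v ∈ S.T.verts ∧ v ≠ r), S.w v

/-- Moving two pebbles along an edge, with pointwise bookkeeping free of subtraction. -/
theorem exists_pebblingMove [DecidableEq V] {G : SimpleGraph V} {C : V → ℕ} {u v : V}
    (huv : G.Adj u v) (hu : 2 ≤ C u) :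
    ∃ C' : V → ℕ, PebblingMove G C C' ∧
      ∀ x, C' x + (if x = u then 2 else 0) = C x + (if x = v then 1 else 0) := by
  have hne : u ≠ v := huv.ne
  refine ⟨fun x => if x = u then C x - 2 else if x = v then C x + 1 else C x,
    ⟨u, v, huv, hu, by simp, by simp [hne.symm], ?_⟩, ?_⟩
  · intro x hxu hxv
    simp [hxu, hxv]
  · intro x
    grind

theorem PebblingSolvable.of_move {G : SimpleGraph V} {r : V} {C C' : V → ℕ}
    (h : PebblingMove G C C') (hs : PebblingSolvable G r C') : PebblingSolvable G r C := by
  obtain ⟨D, hD, hr⟩ := hs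
  exact ⟨D, .head h hD, hr⟩

/-- If a configuration outweighs the tree of a strategy, some vertex of positive weight carries
at least two pebbles. -/
theorem Strategy.exists_two_le_of_treeWeight_lt [Fintype V] {G : SimpleGraph V} {r : V}
    (S : Strategy G r) {C : V → ℕ} (hC : treeWeight S < configWeight S C) :
    ∃ v, 0 < S.w v ∧ 2 ≤ C v := by
  classical
  by_contra! hcon
  refine hC.not_ge ?_
  have htree : treeWeight S = ∑ v, S.w v := by
    rw [treeWeight]
    refine Finset.sum_subset (Finset.subset_univ _) fun v _ hv => ?_
    by_cases hvr : v = r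
    · rw [hvr, S.w_root]
    · exact S.w_outside v fun hvT => hv (by simp [hvT, hvr])
  rw [htree, configWeight]
  refine Finset.sum_le_sum fun v _ => ?_
  rcases (S.w_nonneg v).eq_or_lt with h0 | hpos
  · simp [← h0]
  · have hle : (C v : ℚ) ≤ 1 := by exact_mod_cast Nat.le_of_lt_succ (hcon v hpos)
    exact mul_le_of_le_one_right hpos.le hle

/-- A vertex of positive weight is adjacent to the root, or has a neighbor of twice its weight. -/
theorem Strategy.adj_root_or_exists_adj_two_mul {G : SimpleGraph V} {r : V}
    (S : Strategy G r) {v : V} (hv : 0 < S.w v) :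
    G.Adj v r ∨ ∃ u, G.Adj v u ∧ S.w u = 2 * S.w v := by
  have hvT : v ∈ S.T.verts := by
    by_contra hvT
    exact hv.ne' (S.w_outside v hvT)
  have hvr : v ≠ r := by
    rintro rfl
    exact hv.ne' S.w_root
  by_cases hadj : S.T.Adj r v
  · exact .inl hadj.symm.adj_sub
  refine .inr ?_
  obtain ⟨p, hp⟩ :=
    S.isTree.connected.exists_walk_length_eq_dist (⟨v, hvT⟩ : S.T.verts) ⟨r, S.root_mem⟩
  generalize hroot : (⟨r, S.root_mem⟩ : S.T.verts) = s at p hp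
  cases p with
  | nil => exact absurd (congrArg Subtype.val hroot).symm hvr
  | @cons _ u _ huv q =>
    subst hroot
    have hvu : S.T.Adj v u := huv
    refine ⟨u, hvu.adj_sub, S.w_parent u ⟨v, hvT⟩ huv.symm hvr hadj ?_⟩
    have hq := SimpleGraph.dist_le q
    rw [SimpleGraph.Walk.length_cons] at hp
    omega

/-- The weight function lemma: a configuration outweighing the tree of a strategy is solvable. -/
theorem Strategy.solvable_of_treeWeight_lt [Fintype V] {G : SimpleGraph V} {r : V}
    (S : Strategy G r) (C : V → ℕ) (hC : treeWeight S < configWeight S C) :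
    PebblingSolvable G r C := by
  classical
  induction hn : ∑ v, C v using Nat.strong_induction_on generalizing C with
  | _ n ih =>
    obtain ⟨v, hv, hCv⟩ := S.exists_two_le_of_treeWeight_lt hC
    rcases S.adj_root_or_exists_adj_two_mul hv with hvr | ⟨u, hvu, hu⟩
    · obtain ⟨C', hmove, hC'⟩ := exists_pebblingMove hvr hCv
      have hr := hC' r
      simp only [hvr.ne', if_true, if_false] at hr
      exact .of_move hmove ⟨C', .refl, by omega⟩
    · obtain ⟨C', hmove, hC'⟩ := exists_pebblingMove hvu hCv
      have hsize : ∑ x, C' x + 2 = ∑ x, C x + 1 := by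
        have := Finset.sum_congr (rfl : (univ : Finset V) = univ) fun x _ => hC' x
        simpa [Finset.sum_add_distrib] using this
      have hweight : configWeight S C' = configWeight S C := by
        have hsum : ∑ x, S.w x * ((C' x : ℚ) + if x = v then 2 else 0) =
            ∑ x, S.w x * ((C x : ℚ) + if x = u then 1 else 0) := by
          refine Finset.sum_congr rfl fun x _ => ?_
          congr 1
          exact_mod_cast hC' x
        simp only [mul_add, Finset.sum_add_distrib, mul_ite, mul_zero, mul_one,
          Finset.sum_ite_eq', Finset.mem_univ, if_true] at hsum
        unfold configWeight
        linarith
      exact .of_move hmove (ih _ (by omega) C' (hweight ▸ hC) rfl)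

/-- If every configuration `C` with `C(r) = 0` satisfying all strategy constraints
has size at most `z`, then `π(G,r) ≤ z + 1`. -/
theorem piVertex_le_of_strategy_bound [Fintype V] (G : SimpleGraph V) (hG : G.Connected)
    (hV : 2 ≤ Fintype.card V) (r : V) (z : ℕ)
    (h : ∀ C : V → ℕ, C r = 0 →
      (∀ S : Strategy G r, configWeight S C ≤ treeWeight S) → (∑ v, C v) ≤ z) :
    piVertex G r ≤ z + 1 := by
  refine Nat.sInf_le fun C hC => ?_
  by_contra hns
  have hr : C r = 0 := by
    by_contra hr
    exact hns ⟨C, .refl, Nat.one_le_iff_ne_zero.mpr hr⟩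
  have hle := h C hr fun S => not_lt.mp fun hlt => hns (S.solvable_of_treeWeight_lt C hlt)
  omega
end

section
/- The graph R_15 is Class 0; that is, π(R_15) = 15. -/
open Finset SimpleGraph

variable {V : Type*}

/-- The edges of the random graph `R_15`, with `v_i` represented by `i - 1 : Fin 15`. -/
def r15Edges : List (Fin 15 × Fin 15) :=
  [(0,1), (0,3), (0,4), (0,5), (0,11), (0,12),
   (1,2), (1,3), (1,7), (1,10), (1,11), (1,13),
   (2,3), (2,5), (2,6),
   (3,4), (3,6), (3,8), (3,13),
   (4,5), (4,7), (4,10), (4,14),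
   (5,8), (5,12), (5,13),
   (6,10), (6,14),
   (7,9), (7,12), (7,13), (7,14),
   (8,9), (8,10),
   (9,10),
   (10,11), (10,14),
   (11,12)]

/-- The random graph `R_15`. -/
def R15 : SimpleGraph (Fin 15) :=
  SimpleGraph.fromRel (fun i j => (i, j) ∈ r15Edges)

/-- The configuration obtained from `C` by moving one pebble from `u` to `v`. -/
def pebblingStep [DecidableEq V] (u v : V) (C : V → ℕ) : V → ℕ :=
  fun x => if x = u then C u - 2 else if x = v then C v + 1 else C x

theorem PebblingSolvable.of_step [DecidableEq V] {G : SimpleGraph V} {r : V} (u v : V)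
    {C : V → ℕ} (huv : G.Adj u v) (hu : 2 ≤ C u)
    (h : PebblingSolvable G r (pebblingStep u v C)) : PebblingSolvable G r C := by
  obtain ⟨C', hC', hr⟩ := h
  refine ⟨C', .head ⟨u, v, huv, hu, ?_, ?_, ?_⟩ hC', hr⟩
  · simp [pebblingStep]
  · simp [pebblingStep, huv.ne']
  · intro x hxu hxv
    simp [pebblingStep, hxu, hxv]

theorem pebblingSolvable_of_root {G : SimpleGraph V} {r : V} {C : V → ℕ} (h : 1 ≤ C r) :
    PebblingSolvable G r C :=
  ⟨C, .refl, h⟩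

theorem sum_mul_pebblingStep [Fintype V] [DecidableEq V] (f : V → ℕ) {u v : V} {C : V → ℕ}
    (huv : u ≠ v) (hu : 2 ≤ C u) :
    ∑ x, f x * pebblingStep u v C x + 2 * f u = ∑ x, f x * C x + f v := by
  have h : ∀ x, f x * pebblingStep u v C x + (if x = u then 2 * f x else 0) =
      f x * C x + (if x = v then f x else 0) := by
    intro x
    by_cases hxu : x = u
    · subst hxu
      obtain ⟨k, hk⟩ := Nat.exists_eq_add_of_le hu
      simp only [pebblingStep, if_true, huv, if_false, hk, Nat.add_sub_cancel_left]
      ring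
    · by_cases hxv : x = v
      · subst hxv
        simp only [pebblingStep, hxu, if_true, if_false]
        ring
      · simp [pebblingStep, hxu, hxv]
  simpa [Finset.sum_add_distrib] using Finset.sum_congr rfl fun x (_ : x ∈ univ) => h x

/-- A weight function vanishing at `r` such that every vertex of positive weight has a neighbor
that is either `r` or at least twice as heavy. -/
def IsPebblingWeight (G : SimpleGraph V) (r : V) (w : V → ℕ) : Prop :=
  w r = 0 ∧ ∀ v, w v = 0 ∨ ∃ u, G.Adj v u ∧ (u = r ∨ 2 * w v ≤ w u)

instance [Fintype V] [DecidableEq V] (G : SimpleGraph V) [DecidableRel G.Adj] (r : V)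
    (w : V → ℕ) : Decidable (IsPebblingWeight G r w) :=
  inferInstanceAs (Decidable (_ ∧ _))

/-- The weight function lemma. -/
theorem IsPebblingWeight.sum_mul_le [Fintype V] [DecidableEq V] {G : SimpleGraph V} {r : V}
    {w : V → ℕ} (hw : IsPebblingWeight G r w) {C : V → ℕ} (hC : ¬ PebblingSolvable G r C) :
    ∑ v, w v * C v ≤ ∑ v, w v := by
  induction hn : ∑ v, C v using Nat.strong_induction_on generalizing C with
  | _ n ih =>
    by_cases hbig : ∃ v, w v ≠ 0 ∧ 2 ≤ C v
    · obtain ⟨v, hwv, hv⟩ := hbig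
      obtain ⟨u, hvu, hu⟩ := (hw.2 v).resolve_left hwv
      have hstep : ¬ PebblingSolvable G r (pebblingStep v u C) := fun h => hC (h.of_step v u hvu hv)
      rcases hu with rfl | hu
      · exact absurd (pebblingSolvable_of_root (by simp [pebblingStep, hvu.ne'])) hstep
      · have h₁ := sum_mul_pebblingStep (fun _ => 1) hvu.ne hv
        have h₂ := sum_mul_pebblingStep w hvu.ne hv
        simp only [one_mul] at h₁
        have h₃ := ih _ (by omega) hstep rfl
        omega
    · push Not at hbig
      refine Finset.sum_le_sum fun v _ => ?_
      by_cases hv : w v = 0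
      · simp [hv]
      · exact (Nat.mul_le_mul_left _ (Nat.le_of_lt_succ (hbig v hv))).trans_eq (mul_one _)

/-- The nonnegative integer combination of weight functions given by a list of pairs
(coefficient, weight function). -/
def combinedWeight (L : List (ℕ × (V → ℕ))) (v : V) : ℕ :=
  (L.map fun p => p.1 * p.2 v).sum

theorem sum_combinedWeight_mul_le [Fintype V] [DecidableEq V] {G : SimpleGraph V} {r : V}
    {L : List (ℕ × (V → ℕ))} (hL : ∀ p ∈ L, IsPebblingWeight G r p.2) {C : V → ℕ}
    (hC : ¬ PebblingSolvable G r C) :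
    ∑ v, combinedWeight L v * C v ≤ ∑ v, combinedWeight L v := by
  induction L with
  | nil => simp [combinedWeight]
  | cons p L ih =>
    have h₁ := Nat.mul_le_mul_left p.1 ((hL p (by simp)).sum_mul_le hC)
    have h₂ := ih fun q hq => hL q (by simp [hq])
    simp only [combinedWeight, List.map_cons, List.sum_cons, add_mul, mul_assoc,
      Finset.sum_add_distrib, ← Finset.mul_sum] at h₂ ⊢
    exact add_le_add h₁ h₂

theorem solvable_of_certificate [Fintype V] [DecidableEq V] {G : SimpleGraph V} {r : V} {n : ℕ}
    (Z : Finset V) (D : ℕ) (L : List (ℕ × (V → ℕ)))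
    (hL : (∀ p ∈ L, IsPebblingWeight G r p.2) ∧ (∀ v, v = r ∨ v ∈ Z ∨ D ≤ combinedWeight L v) ∧
      ∑ v, combinedWeight L v < D * n)
    {C : V → ℕ} (hC : ∑ v, C v = n) (hZ : ∀ v ∈ Z, C v = 0) : PebblingSolvable G r C := by
  by_contra hns
  have hr : C r = 0 := by
    by_contra h
    exact hns (pebblingSolvable_of_root (Nat.one_le_iff_ne_zero.2 h))
  have h₁ := sum_combinedWeight_mul_le hL.1 hns
  have h₂ : D * n ≤ ∑ v, combinedWeight L v * C v := by
    rw [← hC, Finset.mul_sum]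
    refine Finset.sum_le_sum fun v _ => ?_
    rcases hL.2.1 v with rfl | hv | hv
    · simp [hr]
    · simp [hZ v hv]
    · exact Nat.mul_le_mul_right _ hv
  exact (h₁.trans_lt hL.2.2).not_ge h₂

theorem eq_of_reflTransGen_pebblingMove {G : SimpleGraph V} {C C' : V → ℕ} (hC : ∀ v, C v ≤ 1)
    (h : Relation.ReflTransGen (PebblingMove G) C C') : C' = C := by
  rcases h.cases_head with h | ⟨_, ⟨u, -, -, hu, -⟩, -⟩
  · exact h.symm
  · exact absurd (hC u) (by omega)

theorem card_le_piVertex [Fintype V] {G : SimpleGraph V} {r : V} {n : ℕ}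
    (h : ∀ C : V → ℕ, ∑ v, C v = n → PebblingSolvable G r C) :
    Fintype.card V ≤ piVertex G r := by
  classical
  refine le_csInf ⟨n, h⟩ fun t ht => ?_
  by_contra hlt
  have hcard : t ≤ (univ.erase r).card := by
    rw [Finset.card_erase_of_mem (mem_univ r), Finset.card_univ]
    omega
  obtain ⟨s, hs, rfl⟩ := Finset.exists_subset_card_eq hcard
  obtain ⟨C', hC', hr⟩ := ht (fun v => if v ∈ s then 1 else 0) (by simp)
  have hrs : r ∉ s := fun hr => by simpa using hs hr
  rw [eq_of_reflTransGen_pebblingMove (fun v => by split_ifs <;> simp) hC'] at hr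
  simp [hrs] at hr

instance : DecidableRel R15.Adj :=
  fun i j => inferInstanceAs (Decidable (i ≠ j ∧ ((i, j) ∈ r15Edges ∨ (j, i) ∈ r15Edges)))

theorem r15_solvable_of_forall_ne_zero {C : Fin 15 → ℕ} (hC : ∑ v, C v = 15) (h₁ : C 1 ≠ 0)
    (h₃ : C 3 ≠ 0) (h₄ : C 4 ≠ 0) (h₅ : C 5 ≠ 0) : PebblingSolvable R15 9 C := by
  by_contra hns
  have h₀ : C 0 < 4 := by
    by_contra h
    refine hns (.of_step 0 1 (by decide) ?_ (.of_step 0 4 (by decide) ?_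
      (.of_step 1 7 (by decide) ?_ (.of_step 4 7 (by decide) ?_ (.of_step 7 9 (by decide) ?_
      (pebblingSolvable_of_root ?_)))))) <;> (try simp [pebblingStep]) <;> omega
  have h₂ : C 2 < 4 := by
    by_contra h
    refine hns (.of_step 2 3 (by decide) ?_ (.of_step 2 5 (by decide) ?_
      (.of_step 3 8 (by decide) ?_ (.of_step 5 8 (by decide) ?_ (.of_step 8 9 (by decide) ?_
      (pebblingSolvable_of_root ?_)))))) <;> (try simp [pebblingStep]) <;> omega
  have h₀₂ : C 0 < 2 ∨ C 2 < 2 := by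
    by_contra h
    refine hns (.of_step 2 1 (by decide) ?_ (.of_step 0 4 (by decide) ?_
      (.of_step 1 7 (by decide) ?_ (.of_step 4 7 (by decide) ?_ (.of_step 7 9 (by decide) ?_
      (pebblingSolvable_of_root ?_)))))) <;> (try simp [pebblingStep]) <;> omega
  have h₉ : C 9 = 0 := by
    by_contra h
    exact hns (pebblingSolvable_of_root (Nat.one_le_iff_ne_zero.2 h))
  have h := sum_combinedWeight_mul_le (G := R15) (r := 9)
    (L := [(64, ![1, 2, 1, 1, 2, 1, 1, 4, 0, 0, 0, 1, 2, 2, 2]),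
           (16, ![1, 2, 1, 1, 2, 1, 0, 0, 0, 0, 4, 2, 0, 1, 2]),
           (64, ![1, 2, 1, 1, 2, 1, 2, 0, 0, 0, 4, 2, 1, 1, 2]),
           (32, ![2, 2, 2, 4, 2, 4, 2, 0, 8, 0, 0, 1, 2, 2, 1])])
    (by decide +kernel) hns
  simp [combinedWeight, Fin.sum_univ_succ] at h hC
  omega

theorem r15_solvable_nine {C : Fin 15 → ℕ} (hC : ∑ v, C v = 15) : PebblingSolvable R15 9 C := by
  by_cases h₁ : C 1 = 0
  · exact solvable_of_certificate {1} 2192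
      [(232, ![2, 0, 2, 4, 2, 0, 0, 0, 8, 0, 0, 0, 0, 2, 1]),
       (364, ![0, 0, 1, 0, 0, 2, 0, 0, 4, 0, 0, 0, 1, 1, 0]),
       (480, ![1, 0, 1, 0, 0, 0, 2, 0, 0, 0, 4, 2, 0, 0, 0]),
       (158, ![2, 0, 2, 2, 4, 2, 4, 0, 0, 0, 8, 4, 2, 1, 4]),
       (212, ![2, 0, 1, 2, 4, 2, 2, 8, 0, 0, 0, 2, 4, 4, 4]),
       (152, ![1, 0, 0, 0, 0, 0, 1, 4, 0, 0, 0, 0, 2, 0, 2]),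
       (182, ![2, 0, 2, 4, 2, 4, 2, 0, 8, 0, 0, 1, 2, 2, 1])]
      (by decide +kernel) hC (by simpa using h₁)
  by_cases h₃ : C 3 = 0
  · exact solvable_of_certificate {3} 64
      [(4, ![2, 1, 2, 0, 0, 4, 1, 0, 8, 0, 0, 1, 2, 2, 0]),
       (16, ![1, 0, 1, 0, 0, 0, 2, 0, 0, 0, 4, 2, 0, 0, 0]),
       (14, ![2, 4, 2, 0, 4, 2, 2, 8, 1, 0, 2, 2, 4, 4, 4]),
       (8, ![1, 0, 1, 0, 1, 2, 0, 0, 4, 0, 0, 0, 0, 0, 0]),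
       (4, ![1, 2, 1, 0, 0, 1, 0, 4, 0, 0, 0, 1, 0, 2, 2])]
      (by decide +kernel) hC (by simpa using h₃)
  by_cases h₄ : C 4 = 0
  · exact solvable_of_certificate {4} 32
      [(6, ![2, 4, 2, 2, 0, 2, 2, 8, 1, 0, 2, 2, 4, 4, 4]),
       (8, ![1, 0, 1, 0, 0, 0, 2, 0, 0, 0, 4, 2, 0, 0, 0]),
       (4, ![1, 2, 1, 1, 0, 1, 1, 4, 0, 0, 0, 1, 2, 0, 2]),
       (4, ![2, 0, 2, 4, 0, 4, 0, 0, 8, 0, 0, 1, 0, 2, 0])]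
      (by decide +kernel) hC (by simpa using h₄)
  by_cases h₅ : C 5 = 0
  · exact solvable_of_certificate {5} 112
      [(26, ![2, 4, 2, 2, 4, 0, 2, 8, 1, 0, 2, 2, 4, 4, 4]),
       (12, ![1, 0, 1, 2, 0, 0, 1, 0, 4, 0, 0, 0, 0, 0, 0]),
       (4, ![1, 2, 1, 1, 0, 0, 0, 4, 0, 0, 0, 1, 2, 0, 0]),
       (8, ![1, 0, 1, 2, 1, 0, 0, 0, 4, 0, 0, 0, 0, 0, 0]),
       (4, ![2, 0, 2, 4, 0, 0, 0, 0, 8, 0, 0, 1, 0, 2, 0]),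
       (24, ![1, 0, 1, 0, 0, 0, 2, 0, 0, 0, 4, 2, 0, 0, 0]),
       (4, ![1, 2, 1, 0, 0, 0, 0, 4, 0, 0, 0, 1, 0, 0, 2])]
      (by decide +kernel) hC (by simpa using h₅)
  exact r15_solvable_of_forall_ne_zero hC h₁ h₃ h₄ h₅

theorem r15_solvable (r : Fin 15) {C : Fin 15 → ℕ} (hC : ∑ v, C v = 15) :
    PebblingSolvable R15 r C := by
  fin_cases r
  · exact solvable_of_certificate ∅ 256
      [(32, ![0, 4, 4, 8, 4, 2, 4, 2, 4, 2, 2, 2, 1, 4, 2]),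
       (40, ![0, 0, 0, 0, 4, 0, 1, 0, 0, 1, 2, 0, 0, 0, 2]),
       (48, ![0, 0, 0, 0, 0, 0, 1, 0, 0, 1, 2, 4, 0, 0, 1]),
       (28, ![0, 0, 0, 0, 0, 0, 0, 4, 1, 2, 1, 0, 8, 2, 0]),
       (40, ![0, 4, 2, 0, 0, 0, 0, 2, 0, 1, 0, 0, 0, 2, 1]),
       (26, ![0, 0, 4, 0, 0, 8, 2, 0, 4, 2, 0, 0, 0, 0, 1])]
      (by decide +kernel) hC (by simp)
  · exact solvable_of_certificate ∅ 160
      [(12, ![4, 0, 1, 2, 2, 2, 2, 2, 2, 2, 4, 8, 4, 1, 2]),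
       (12, ![2, 0, 8, 4, 2, 4, 4, 1, 2, 1, 2, 1, 2, 2, 2]),
       (12, ![2, 0, 1, 2, 4, 2, 2, 8, 2, 4, 2, 2, 4, 4, 4]),
       (12, ![2, 0, 2, 2, 4, 2, 4, 2, 4, 4, 8, 4, 2, 1, 4]),
       (12, ![2, 0, 0, 4, 0, 1, 0, 0, 2, 1, 0, 0, 1, 0, 0]),
       (8, ![2, 0, 2, 4, 2, 4, 2, 4, 2, 2, 1, 1, 2, 8, 2])]
      (by decide +kernel) hC (by simp)
  · exact solvable_of_certificate ∅ 320
      [(48, ![0, 0, 0, 0, 2, 0, 8, 2, 0, 2, 4, 2, 1, 1, 4]),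
       (44, ![4, 2, 0, 2, 4, 8, 1, 2, 4, 2, 2, 2, 4, 4, 2]),
       (4, ![0, 0, 0, 0, 0, 8, 0, 2, 4, 2, 0, 0, 0, 4, 1]),
       (28, ![0, 4, 0, 0, 0, 0, 0, 2, 0, 1, 0, 0, 1, 0, 0]),
       (4, ![4, 0, 0, 8, 4, 0, 0, 2, 0, 1, 2, 2, 2, 4, 2]),
       (32, ![0, 4, 0, 0, 1, 0, 0, 2, 0, 1, 2, 2, 1, 2, 1]),
       (64, ![2, 0, 0, 4, 0, 0, 0, 0, 2, 1, 0, 1, 1, 0, 0])]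
      (by decide +kernel) hC (by simp)
  · exact solvable_of_certificate ∅ 192
      [(32, ![2, 4, 2, 0, 1, 1, 1, 2, 1, 1, 2, 2, 1, 2, 1]),
       (28, ![0, 2, 0, 0, 0, 0, 0, 2, 0, 1, 0, 1, 1, 4, 1]),
       (16, ![8, 4, 2, 0, 4, 4, 1, 2, 2, 1, 2, 4, 4, 2, 2]),
       (18, ![0, 0, 0, 0, 0, 0, 8, 0, 0, 2, 4, 2, 1, 0, 4]),
       (12, ![0, 0, 0, 0, 8, 0, 0, 0, 0, 2, 4, 2, 1, 0, 4]),
       (4, ![0, 0, 16, 0, 0, 8, 0, 2, 0, 1, 0, 0, 4, 0, 1]),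
       (16, ![0, 0, 2, 0, 0, 4, 0, 2, 8, 4, 0, 0, 2, 0, 1])]
      (by decide +kernel) hC (by simp)
  · exact solvable_of_certificate ∅ 656
      [(64, ![2, 2, 2, 4, 0, 1, 2, 1, 2, 1, 1, 1, 1, 2, 1]),
       (8, ![1, 2, 2, 2, 0, 1, 4, 4, 2, 2, 4, 2, 2, 2, 8]),
       (24, ![4, 0, 1, 2, 0, 0, 0, 0, 0, 0, 0, 2, 0, 0, 0]),
       (32, ![0, 0, 2, 0, 0, 4, 0, 1, 0, 0, 0, 1, 2, 0, 0]),
       (80, ![1, 2, 1, 1, 0, 1, 1, 4, 1, 2, 1, 1, 2, 2, 2]),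
       (160, ![1, 2, 1, 1, 0, 1, 2, 1, 2, 2, 4, 2, 1, 1, 2]),
       (48, ![4, 2, 4, 2, 0, 8, 2, 2, 4, 2, 2, 2, 4, 4, 1])]
      (by decide +kernel) hC (by simp)
  · exact solvable_of_certificate ∅ 576
      [(48, ![8, 4, 2, 4, 4, 0, 2, 2, 2, 1, 2, 4, 4, 2, 2]),
       (26, ![2, 4, 8, 4, 2, 0, 4, 2, 2, 1, 2, 2, 1, 2, 2]),
       (48, ![0, 0, 0, 0, 4, 0, 1, 0, 0, 1, 2, 1, 0, 0, 2]),
       (72, ![2, 2, 2, 4, 2, 0, 2, 2, 8, 4, 4, 2, 1, 2, 2]),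
       (30, ![0, 0, 8, 0, 0, 0, 4, 0, 0, 1, 2, 1, 0, 0, 2]),
       (36, ![0, 4, 0, 0, 0, 0, 1, 4, 0, 2, 0, 2, 0, 8, 2]),
       (38, ![0, 0, 0, 0, 0, 0, 1, 4, 0, 2, 0, 4, 8, 2, 2])]
      (by decide +kernel) hC (by simp)
  · exact solvable_of_certificate ∅ 352
      [(88, ![0, 2, 0, 0, 0, 0, 0, 0, 0, 2, 4, 2, 1, 1, 0]),
       (56, ![1, 2, 4, 0, 0, 2, 0, 1, 1, 0, 0, 1, 0, 1, 0]),
       (68, ![2, 0, 0, 4, 2, 0, 0, 1, 2, 1, 0, 1, 1, 2, 0]),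
       (32, ![0, 2, 0, 0, 4, 2, 0, 4, 1, 2, 0, 0, 2, 0, 8]),
       (16, ![2, 0, 0, 0, 4, 2, 0, 4, 0, 0, 0, 1, 2, 0, 8]),
       (36, ![2, 0, 8, 0, 2, 4, 0, 1, 2, 1, 0, 1, 2, 2, 0]),
       (28, ![2, 0, 0, 4, 0, 0, 0, 0, 2, 1, 0, 0, 1, 2, 0])]
      (by decide +kernel) hC (by simp)
  · exact solvable_of_certificate ∅ 1216
      [(188, ![2, 4, 2, 2, 1, 1, 1, 0, 1, 1, 2, 2, 1, 2, 1]),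
       (154, ![1, 2, 1, 2, 2, 2, 2, 0, 4, 8, 4, 2, 1, 1, 2]),
       (118, ![4, 2, 2, 2, 2, 4, 1, 0, 2, 1, 2, 4, 8, 2, 1]),
       (64, ![0, 0, 2, 0, 8, 4, 1, 0, 2, 0, 0, 0, 0, 0, 0]),
       (58, ![2, 0, 2, 4, 0, 0, 2, 0, 2, 0, 0, 1, 0, 8, 0]),
       (54, ![2, 0, 4, 4, 0, 0, 8, 0, 2, 0, 0, 1, 0, 0, 16])]
      (by decide +kernel) hC (by simp)
  · exact solvable_of_certificate ∅ 1552
      [(152, ![0, 2, 1, 0, 0, 0, 2, 1, 0, 0, 4, 2, 1, 1, 2]),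
       (40, ![0, 0, 1, 0, 0, 0, 2, 8, 0, 16, 0, 0, 4, 0, 4]),
       (192, ![4, 2, 4, 2, 4, 8, 2, 2, 0, 1, 2, 2, 4, 4, 2]),
       (40, ![0, 2, 0, 1, 0, 0, 0, 4, 0, 8, 0, 1, 2, 0, 0]),
       (144, ![1, 2, 1, 1, 2, 1, 2, 1, 0, 2, 4, 2, 1, 1, 2]),
       (144, ![1, 0, 0, 0, 0, 0, 0, 1, 0, 0, 4, 2, 0, 0, 2]),
       (124, ![4, 4, 4, 8, 4, 2, 4, 2, 0, 1, 2, 2, 2, 4, 2])]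
      (by decide +kernel) hC (by simp)
  · exact r15_solvable_nine hC
  · exact solvable_of_certificate ∅ 640
      [(100, ![2, 4, 2, 2, 1, 1, 1, 2, 1, 1, 0, 2, 1, 2, 1]),
       (56, ![4, 0, 1, 0, 0, 2, 0, 0, 0, 0, 0, 8, 4, 1, 0]),
       (52, ![0, 0, 0, 0, 2, 1, 2, 2, 0, 0, 0, 0, 1, 1, 4]),
       (36, ![0, 0, 0, 0, 4, 2, 0, 0, 0, 0, 0, 0, 1, 1, 0]),
       (72, ![2, 2, 4, 4, 2, 2, 8, 2, 2, 1, 0, 1, 1, 2, 4]),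
       (50, ![2, 2, 2, 4, 2, 4, 2, 2, 8, 4, 0, 1, 2, 2, 1]),
       (34, ![0, 0, 0, 0, 2, 1, 0, 4, 0, 8, 0, 0, 2, 2, 0])]
      (by decide +kernel) hC (by simp)
  · exact solvable_of_certificate ∅ 1440
      [(80, ![0, 0, 2, 0, 0, 4, 1, 4, 0, 2, 0, 0, 8, 2, 0]),
       (80, ![0, 0, 0, 0, 0, 4, 1, 4, 0, 0, 0, 0, 8, 2, 2]),
       (100, ![4, 0, 1, 0, 2, 2, 0, 0, 1, 0, 0, 0, 0, 1, 0]),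
       (140, ![0, 4, 2, 2, 1, 1, 0, 0, 1, 0, 0, 0, 0, 2, 0]),
       (86, ![0, 0, 2, 2, 0, 0, 4, 0, 0, 4, 8, 0, 0, 1, 4]),
       (66, ![0, 0, 1, 2, 0, 2, 0, 2, 4, 4, 8, 0, 0, 0, 4]),
       (170, ![2, 4, 2, 2, 4, 2, 4, 2, 4, 4, 8, 0, 1, 2, 4]),
       (192, ![4, 0, 1, 2, 2, 0, 1, 1, 1, 0, 0, 0, 0, 1, 0]),
       (72, ![0, 4, 2, 2, 1, 0, 1, 2, 1, 0, 0, 0, 0, 2, 0])]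
      (by decide +kernel) hC (by simp)
  · exact solvable_of_certificate ∅ 1728
      [(204, ![8, 4, 2, 4, 4, 0, 2, 0, 0, 1, 2, 0, 0, 2, 2]),
       (136, ![0, 2, 0, 0, 1, 0, 1, 0, 1, 0, 2, 4, 0, 0, 1]),
       (332, ![0, 1, 2, 0, 0, 4, 1, 0, 2, 1, 0, 0, 0, 2, 0]),
       (52, ![0, 0, 1, 1, 0, 0, 2, 8, 0, 4, 0, 0, 0, 0, 4]),
       (176, ![4, 2, 0, 2, 2, 0, 1, 0, 1, 0, 0, 0, 0, 0, 1]),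
       (180, ![0, 0, 1, 1, 0, 0, 2, 0, 0, 2, 4, 8, 0, 0, 0]),
       (212, ![0, 1, 2, 0, 2, 4, 1, 0, 2, 0, 0, 0, 0, 0, 1]),
       (328, ![0, 0, 0, 1, 0, 0, 0, 4, 1, 2, 1, 0, 0, 2, 2])]
      (by decide +kernel) hC (by simp)
  · exact solvable_of_certificate ∅ 32
      [(8, ![2, 0, 0, 4, 2, 0, 2, 0, 0, 0, 1, 1, 1, 0, 1]),
       (4, ![2, 4, 0, 0, 1, 0, 1, 0, 0, 0, 2, 2, 1, 0, 1]),
       (4, ![2, 4, 2, 0, 0, 0, 1, 0, 0, 1, 2, 0, 0, 0, 1]),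
       (12, ![0, 0, 2, 0, 0, 4, 1, 0, 2, 1, 0, 1, 2, 0, 0]),
       (4, ![0, 0, 0, 0, 4, 0, 0, 8, 2, 4, 2, 1, 0, 0, 4])]
      (by decide +kernel) hC (by simp)
  · exact solvable_of_certificate ∅ 240
      [(40, ![1, 2, 0, 0, 0, 1, 0, 4, 0, 2, 0, 1, 2, 2, 0]),
       (24, ![4, 0, 2, 4, 8, 4, 0, 0, 2, 1, 0, 2, 2, 2, 0]),
       (24, ![2, 0, 4, 4, 0, 2, 8, 0, 2, 1, 0, 1, 1, 2, 0]),
       (32, ![1, 2, 1, 0, 0, 0, 0, 4, 1, 2, 0, 0, 2, 0, 0]),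
       (24, ![1, 2, 1, 1, 2, 1, 2, 1, 2, 2, 4, 2, 1, 1, 0]),
       (40, ![0, 2, 1, 1, 0, 1, 0, 0, 2, 0, 4, 2, 0, 1, 0])]
      (by decide +kernel) hC (by simp)

/-- `R_15` is Class 0: `π(R_15) = 15`. -/
theorem r15_class0 : pebblingNumber R15 = 15 := by
  apply le_antisymm
  · exact Finset.sup_le fun r _ => Nat.sInf_le fun C hC => r15_solvable r hC
  · exact (card_le_piVertex fun C hC => r15_solvable 0 hC).trans
      (Finset.le_sup (f := piVertex R15) (mem_univ 0))
end
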